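/- Let G be a finite Coxeter group with three generators whose Coxeter graph is a path (i.e., of type A₃, B₃ = C₃, or H₃), and let V₃ be its reflection representation. Then H_C^1(G, V₃) ≅ ℝ², and H_C^i(G, V₃) = 0 for all i ≠ 1. -/

import Mathlib

set_option linter.unusedSectionVars false

open Finset

section CoxeterCochain

variable {B : Type*} [DecidableEq B] [Fintype B]
variable {W : Type*} [Group W] {M : CoxeterMatrix B} (cs : CoxeterSystem M W)

/-- A subset `T` of the generating set is *independent* if the corresponding simple
reflections pairwise commute. -/
def Indep (T : Finset B) : Prop :=
  ∀ i ∈ T, ∀ j ∈ T, i ≠ j → Commute (cs.simple i) (cs.simple j)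

lemma Indep.mono {T T' : Finset B} (hT : Indep cs T) (h : T' ⊆ T) : Indep cs T' :=
  fun i hi j hj hij => hT i (h hi) j (h hj) hij

variable (R : Type*) [CommRing R] (A : Type*) [AddCommGroup A] [Module R A]
  [DistribMulAction W A] [SMulCommClass W R A]

/-- The submodule of invariants `A^{⟨T⟩}` of the subgroup generated by the
simple reflections indexed by `T`. -/
def invSub (T : Finset B) : Submodule R A where
  carrier := {a | ∀ i ∈ T, cs.simple i • a = a}
  add_mem' ha hb := fun i hi => by rw [smul_add, ha i hi, hb i hi]
  zero_mem' := fun i hi => smul_zero _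
  smul_mem' r a ha := fun i hi => by rw [smul_comm, ha i hi]

lemma mem_invSub {T : Finset B} {a : A} :
    a ∈ invSub cs R A T ↔ ∀ i ∈ T, cs.simple i • a = a := Iff.rfl

/-- The degree `k` part of the Coxeter cochain complex: the direct sum (= product, as the
index set is finite) over all independent `k`-element subsets `T` of the invariants `A^{⟨T⟩}`. -/
abbrev Xc (k : ℕ) : Type _ :=
  ∀ T : {T : Finset B // Indep cs T ∧ T.card = k}, invSub cs R A T.1

/-- The sign `(-1)^{#{t ∈ T | t < s}}` (with respect to a chosen linear order on `B`). -/
def csgn (o : LinearOrder B) (T : Finset B) (s : B) : ℤ :=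
  letI := o
  (-1) ^ (T.filter (fun t => t < s)).card

lemma step_mem {T : Finset B} (hT : Indep cs T) {s : B} (hs : s ∈ T) {a : A}
    (ha : a ∈ invSub cs R A (T.erase s)) :
    a + cs.simple s • a ∈ invSub cs R A T := by
  intro i hi
  rcases eq_or_ne i s with rfl | h
  · rw [smul_add, smul_smul, cs.simple_mul_simple_self, one_smul, add_comm]
  · have hcomm : Commute (cs.simple i) (cs.simple s) := hT i hi s hs h
    have hai : cs.simple i • a = a := ha i (Finset.mem_erase.mpr ⟨h, hi⟩)
    rw [smul_add, hai, smul_smul, hcomm.eq, ← smul_smul, hai]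

/-- The independent set obtained by deleting `s` from `U`. -/
def Usub {k : ℕ} (U : {T : Finset B // Indep cs T ∧ T.card = k + 1}) (s : {x // x ∈ U.1}) :
    {T : Finset B // Indep cs T ∧ T.card = k} :=
  ⟨U.1.erase s.1, Indep.mono cs U.2.1 (Finset.erase_subset _ _),
    by simp [Finset.card_erase_of_mem s.2, U.2.2]⟩

/-- The differential of the Coxeter cochain complex: the sum of the maps
`d_{T,s} : v ↦ (-1)^{#{t ∈ T | t < s}} (v + s • v)`. -/
def Xd (o : LinearOrder B) (k : ℕ) : Xc cs R A k →ₗ[R] Xc cs R A (k + 1) where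
  toFun x U :=
    ⟨∑ s ∈ U.1.attach,
        csgn o (U.1.erase s.1) s.1 •
          ((x (Usub cs U s) : A) + cs.simple s.1 • (x (Usub cs U s) : A)),
      Submodule.sum_mem _ fun s _ => zsmul_mem
        (step_mem cs R A U.2.1 s.2 (x (Usub cs U s)).2) _⟩
  map_add' x y := by
    funext U
    apply Subtype.ext
    simp only [Pi.add_apply, Submodule.coe_add]
    rw [← Finset.sum_add_distrib]
    refine Finset.sum_congr rfl fun s _ => ?_
    rw [← smul_add]
    congr 1
    rw [smul_add]
    abel
  map_smul' r x := by
    funext U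
    apply Subtype.ext
    simp only [Pi.smul_apply, SetLike.val_smul, RingHom.id_apply]
    rw [Finset.smul_sum]
    refine Finset.sum_congr rfl fun s _ => ?_
    rw [smul_comm (cs.simple s.1) r, ← smul_add, smul_comm]

/-- Cocycles of the Coxeter cochain complex. -/
def Zc (o : LinearOrder B) (i : ℕ) : Submodule R (Xc cs R A i) := LinearMap.ker (Xd cs R A o i)

/-- Coboundaries of the Coxeter cochain complex. -/
def Bc (o : LinearOrder B) : (i : ℕ) → Submodule R (Xc cs R A i)
  | 0 => ⊥
  | (i + 1) => LinearMap.range (Xd cs R A o i)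

/-- The Coxeter cohomology `H^i_C(G, A)` of the Coxeter system `cs` with coefficients in `A`,
with respect to the linear order `o` on the generators. -/
abbrev CoxH (o : LinearOrder B) (i : ℕ) : Type _ :=
  Zc cs R A o i ⧸ (Bc cs R A o i).comap (Zc cs R A o i).subtype

end CoxeterCochain

section ReflectionRep

open scoped RealInnerProductSpace

variable {B : Type*} {W : Type*} [Group W] {M : CoxeterMatrix B}

/-- `V`, with the given action of `W` and the family `α` of simple roots, is a reflection
representation of the Coxeter system `cs`: it is a real inner product space of dimension equal
to the rank, spanned by the nonzero simple roots, on which each simple reflection acts as the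
orthogonal reflection in the hyperplane perpendicular to the corresponding simple root, and the
angle between the simple roots `α i` and `α j` is `π - π / M i j`. -/
structure IsReflectionRep [Fintype B] (cs : CoxeterSystem M W) (V : Type*)
    [NormedAddCommGroup V] [InnerProductSpace ℝ V] [DistribMulAction W V]
    [SMulCommClass W ℝ V] (α : B → V) : Prop where
  finrank_eq : Module.finrank ℝ V = Fintype.card B
  span_eq : Submodule.span ℝ (Set.range α) = ⊤
  alpha_ne : ∀ i, α i ≠ 0
  smul_eq : ∀ i v, cs.simple i • v = v - (2 * ⟪α i, v⟫ / ⟪α i, α i⟫) • α i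
  inner_eq : ∀ i j, i ≠ j →
    ⟪α i, α j⟫ = -Real.cos (Real.pi / (M i j : ℝ)) * (‖α i‖ * ‖α j‖)

end ReflectionRep

/-- Two Coxeter matrices describe the same type of Coxeter group if one is obtained from the
other by reindexing the generators. -/
def SameCoxeterType {B B' : Type*} (M : CoxeterMatrix B) (M' : CoxeterMatrix B') : Prop :=
  ∃ e : B ≃ B', ∀ i j, M i j = M' (e i) (e j)


section Helpers

open scoped RealInnerProductSpace

lemma exists_path {M : CoxeterMatrix (Fin 3)}
    (hM : SameCoxeterType M (CoxeterMatrix.Aₙ 3) ∨ SameCoxeterType M (CoxeterMatrix.Bₙ 3) ∨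
      SameCoxeterType M CoxeterMatrix.H₃) :
    ∃ a m b : Fin 3, a ≠ m ∧ m ≠ b ∧ a ≠ b ∧ 3 ≤ M a m ∧ 3 ≤ M m b ∧ M a b = 2 := by
  have key : ∀ M' : CoxeterMatrix (Fin 3), (3 ≤ M' 0 1 ∧ 3 ≤ M' 1 2 ∧ M' 0 2 = 2) →
      SameCoxeterType M M' →
      ∃ a m b : Fin 3, a ≠ m ∧ m ≠ b ∧ a ≠ b ∧ 3 ≤ M a m ∧ 3 ≤ M m b ∧ M a b = 2 := by
    rintro M' ⟨h1, h2, h3⟩ ⟨e, he⟩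
    refine ⟨e.symm 0, e.symm 1, e.symm 2, by simp, by simp, by simp, ?_, ?_, ?_⟩ <;>
      simpa [he]
  rcases hM with h | h | h
  · exact key _ (by decide) h
  · exact key _ (by decide) h
  · exact key _ (by decide) h

/-- Extension by zero of a cochain to all subsets. -/
noncomputable def extz {B W : Type*} [DecidableEq B] [Fintype B] [Group W] {M : CoxeterMatrix B}
    (cs : CoxeterSystem M W) (V : Type*) [AddCommGroup V] [Module ℝ V]
    [DistribMulAction W V] [SMulCommClass W ℝ V] {k : ℕ} (x : Xc cs ℝ V k) (T : Finset B) : V :=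
  open Classical in
  if h : Indep cs T ∧ T.card = k then (x ⟨T, h⟩ : V) else 0

lemma extz_eq {B W : Type*} [DecidableEq B] [Fintype B] [Group W] {M : CoxeterMatrix B}
    (cs : CoxeterSystem M W) (V : Type*) [AddCommGroup V] [Module ℝ V]
    [DistribMulAction W V] [SMulCommClass W ℝ V] {k : ℕ} (x : Xc cs ℝ V k)
    (T : {T : Finset B // Indep cs T ∧ T.card = k}) : extz cs V x T.1 = x T := by
  simp [extz, T.2]

lemma Xd_eq {B W : Type*} [DecidableEq B] [Fintype B] [Group W] {M : CoxeterMatrix B}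
    (cs : CoxeterSystem M W) (V : Type*) [AddCommGroup V] [Module ℝ V]
    [DistribMulAction W V] [SMulCommClass W ℝ V] (o : LinearOrder B) {k : ℕ} (x : Xc cs ℝ V k)
    (U : {T : Finset B // Indep cs T ∧ T.card = k + 1}) :
    (Xd cs ℝ V o k x U : V) = ∑ s ∈ U.1, csgn o (U.1.erase s) s •
      (extz cs V x (U.1.erase s) + cs.simple s • extz cs V x (U.1.erase s)) := by
  rw [← Finset.sum_attach]
  simp only [Xd, LinearMap.coe_mk, AddHom.coe_mk]
  refine Finset.sum_congr rfl fun s _ => ?_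
  have := extz_eq cs V x (Usub cs U s)
  rw [← this]
  rfl

lemma csgn_sq {B : Type*} (o : LinearOrder B) (T : Finset B) (s : B) :
    csgn o T s * csgn o T s = 1 := by
  unfold csgn
  rw [← mul_pow]; simp

lemma csgn_anti {B : Type*} (o : LinearOrder B) (a b : B) (h : a ≠ b) :
    csgn o {b} a = - csgn o {a} b := by
  unfold csgn
  letI := o
  rcases lt_or_gt_of_ne h with h | h
  · simp [Finset.filter_singleton, h, h.not_gt]
  · simp [Finset.filter_singleton, h, h.not_gt]

lemma csgn_empty {B : Type*} (o : LinearOrder B) (a : B) :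
    csgn o ∅ a = 1 := by
  simp [csgn]

variable {M : CoxeterMatrix (Fin 3)} {W : Type*} [Group W] (cs : CoxeterSystem M W)
    {V : Type*} [NormedAddCommGroup V] [InnerProductSpace ℝ V] [DistribMulAction W V]
    [SMulCommClass W ℝ V] {α : Fin 3 → V}

lemma refl_linInd (hV : IsReflectionRep cs V α) : LinearIndependent ℝ α :=
  linearIndependent_of_top_le_span_of_card_eq_finrank hV.span_eq.ge hV.finrank_eq.symm

lemma refl_pair (hV : IsReflectionRep cs V α) {i j : Fin 3} (hij : i ≠ j) (c d : ℝ)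
    (h : c • α i + d • α j = 0) : c = 0 ∧ d = 0 := by
  have h1 := (refl_linInd cs hV).comp ![i, j] (by
    intro x y; fin_cases x <;> fin_cases y <;> simp [hij, hij.symm])
  have h2 : α ∘ ![i, j] = ![α i, α j] := by
    funext x; fin_cases x <;> rfl
  rw [h2] at h1
  exact LinearIndependent.pair_iff.1 h1 c d h

lemma refl_inner_ne (hV : IsReflectionRep cs V α) {i j : Fin 3} (hij : i ≠ j) (h : 3 ≤ M i j) :
    ⟪α i, α j⟫ ≠ 0 := by
  rw [hV.inner_eq i j hij]
  have h1 := norm_ne_zero_iff.2 (hV.alpha_ne i)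
  have h2 := norm_ne_zero_iff.2 (hV.alpha_ne j)
  have h3 : (3 : ℝ) ≤ (M i j : ℝ) := by exact_mod_cast h
  have h4 : 0 < Real.cos (Real.pi / (M i j : ℝ)) := by
    apply Real.cos_pos_of_mem_Ioo
    have := Real.pi_pos
    constructor
    · have : 0 ≤ Real.pi / (M i j : ℝ) := by positivity
      linarith
    · apply div_lt_div_of_pos_left <;> linarith
  exact mul_ne_zero (neg_ne_zero.2 h4.ne') (mul_ne_zero h1 h2)

lemma refl_not_commute (hV : IsReflectionRep cs V α) {i j : Fin 3} (hij : i ≠ j)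
    (h : 3 ≤ M i j) : ¬ Commute (cs.simple i) (cs.simple j) := by
  intro hc
  have hin := refl_inner_ne cs hV hij h
  have hi : ⟪α i, α i⟫ ≠ 0 := inner_self_ne_zero.2 (hV.alpha_ne i)
  have hj : ⟪α j, α j⟫ ≠ 0 := inner_self_ne_zero.2 (hV.alpha_ne j)
  have h1 : cs.simple i • cs.simple j • α i = cs.simple j • cs.simple i • α i := by
    rw [smul_smul, smul_smul, hc.eq]
  have e1 : cs.simple i • α i = - α i := by
    rw [hV.smul_eq, mul_div_assoc, div_self hi, mul_one, two_smul]; abel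
  have e2 := hV.smul_eq j (α i)
  have e3 := hV.smul_eq i (α j)
  rw [e1, smul_neg, e2, smul_sub, e1, smul_comm, e3] at h1
  set c := 2 * ⟪α j, α i⟫ / ⟪α j, α j⟫ with hc'
  set c2 := 2 * ⟪α i, α j⟫ / ⟪α i, α i⟫ with hc2'
  have hcne : c ≠ 0 := by
    rw [hc', real_inner_comm]
    exact div_ne_zero (mul_ne_zero two_ne_zero hin) hj
  have hz : (c * c2) • α i + (-2 * c) • α j = 0 := by
    have := sub_eq_zero.2 h1
    rw [← this]; module
  have := refl_pair cs hV hij _ _ hz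
  have := this.2
  apply hcne; linarith

lemma commute_of_two {i j : Fin 3} (h : M i j = 2) : Commute (cs.simple i) (cs.simple j) := by
  have h1 := cs.simple_mul_simple_pow i j
  rw [h, pow_two] at h1
  have h2 := eq_inv_of_mul_eq_one_left h1
  rw [mul_inv_rev, cs.inv_simple, cs.inv_simple] at h2
  exact h2

lemma indep_iff (hV : IsReflectionRep cs V α) {a m b : Fin 3} (ham : a ≠ m) (hmb : m ≠ b)
    (hab : a ≠ b) (h1 : 3 ≤ M a m) (h2 : 3 ≤ M m b) (h3 : M a b = 2) (T : Finset (Fin 3)) :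
    Indep cs T ↔ ¬ (a ∈ T ∧ m ∈ T) ∧ ¬ (m ∈ T ∧ b ∈ T) := by
  have n1 := refl_not_commute cs hV ham h1
  have n2 := refl_not_commute cs hV hmb h2
  have c := commute_of_two cs h3
  constructor
  · intro h
    exact ⟨fun ⟨x, y⟩ => n1 (h _ x _ y ham), fun ⟨x, y⟩ => n2 (h _ x _ y hmb)⟩
  · rintro ⟨p, q⟩ i hi j hj hij
    have hcov : ∀ a m b : Fin 3, a ≠ m → m ≠ b → a ≠ b → ∀ x, x = a ∨ x = m ∨ x = b := by decide
    rcases hcov a m b ham hmb hab i with rfl | rfl | rfl <;>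
    rcases hcov _ _ _ ham hmb hab j with rfl | rfl | rfl <;>
    first
      | exact absurd rfl hij
      | exact c
      | exact c.symm
      | (exfalso; tauto)

lemma finrank_invSub (hV : IsReflectionRep cs V α) (T : Finset (Fin 3)) :
    Module.finrank ℝ (invSub cs ℝ V T) = 3 - T.card := by
  have hfr : Module.finrank ℝ V = 3 := by simpa using hV.finrank_eq
  haveI : FiniteDimensional ℝ V := FiniteDimensional.of_finrank_pos (by omega)
  have e : invSub cs ℝ V T = (Submodule.span ℝ (Set.range (fun i : T => α i)))ᗮ := by
    ext v
    rw [mem_invSub, Submodule.mem_orthogonal]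
    have hi : ∀ i, ⟪α i, α i⟫ ≠ 0 := fun i => inner_self_ne_zero.2 (hV.alpha_ne i)
    constructor
    · intro h u hu
      induction hu using Submodule.span_induction with
      | mem x hx =>
        obtain ⟨⟨i, hiT⟩, rfl⟩ := hx
        have := h i hiT
        rw [hV.smul_eq, sub_eq_self, smul_eq_zero] at this
        have := this.resolve_right (hV.alpha_ne i)
        have := (div_eq_zero_iff.1 this).resolve_right (hi i)
        simpa using this
      | zero => simp
      | add x y _ _ hx hy => rw [inner_add_left, hx, hy, add_zero]
      | smul r x _ hx => rw [inner_smul_left, hx, mul_zero]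
    · intro h i hiT
      have := h (α i) (Submodule.subset_span ⟨⟨i, hiT⟩, rfl⟩)
      rw [hV.smul_eq, this]; simp
  have h1 := Submodule.finrank_add_finrank_orthogonal
    (Submodule.span ℝ (Set.range (fun i : T => α i)))
  have h2 : Module.finrank ℝ (Submodule.span ℝ (Set.range (fun i : T => α i))) = T.card := by
    have := finrank_span_eq_card ((refl_linInd cs hV).comp (fun i : T => (i : Fin 3))
      Subtype.val_injective)
    rw [Fintype.card_coe] at this
    exact this
  rw [e]; omega

lemma finrank_Xc (hV : IsReflectionRep cs V α) (k : ℕ) :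
    Module.finrank ℝ (Xc cs ℝ V k) =
      Nat.card {T : Finset (Fin 3) // Indep cs T ∧ T.card = k} * (3 - k) := by
  have hfr : Module.finrank ℝ V = 3 := by simpa using hV.finrank_eq
  haveI : FiniteDimensional ℝ V := FiniteDimensional.of_finrank_pos (by omega)
  classical
  rw [Module.finrank_pi_fintype, Finset.sum_congr rfl
    (fun T _ => (finrank_invSub cs hV T.1).trans (by rw [T.2.2])), Finset.sum_const,
    Finset.card_univ, Nat.card_eq_fintype_card, smul_eq_mul]

lemma card_index (a m b : Fin 3) (ham : a ≠ m) (hmb : m ≠ b) (hab : a ≠ b)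
    (hI : ∀ T, Indep cs T ↔ ¬ (a ∈ T ∧ m ∈ T) ∧ ¬ (m ∈ T ∧ b ∈ T)) :
    Nat.card {T : Finset (Fin 3) // Indep cs T ∧ T.card = 0} = 1 ∧
    Nat.card {T : Finset (Fin 3) // Indep cs T ∧ T.card = 1} = 3 ∧
    Nat.card {T : Finset (Fin 3) // Indep cs T ∧ T.card = 2} = 1 := by
  simp only [hI, Nat.card_eq_fintype_card]
  clear hI
  revert a m b
  decide

end Helpers

section Statement

/-- Lemma `threevertices`: for a finite Coxeter group with three generators
whose Coxeter graph is a path (type `A₃`, `B₃ = C₃` or `H₃`) and its reflection representation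
`V₃`, one has `H^1_C(G, V₃) ≅ ℝ²` and `H^i_C(G, V₃) = 0` for `i ≠ 1`. -/
theorem coxeter_cohomology_rank_three_path_reflection_rep
    {M : CoxeterMatrix (Fin 3)}
    (hM : SameCoxeterType M (CoxeterMatrix.Aₙ 3) ∨ SameCoxeterType M (CoxeterMatrix.Bₙ 3) ∨
      SameCoxeterType M CoxeterMatrix.H₃)
    {W : Type*} [Group W] (cs : CoxeterSystem M W) (o : LinearOrder (Fin 3))
    (V : Type*) [NormedAddCommGroup V] [InnerProductSpace ℝ V] [DistribMulAction W V]
    [SMulCommClass W ℝ V] (α : Fin 3 → V) (hV : IsReflectionRep cs V α) :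
    Nonempty (CoxH cs ℝ V o 1 ≃ₗ[ℝ] (Fin 2 → ℝ)) ∧
      ∀ i : ℕ, i ≠ 1 → Subsingleton (CoxH cs ℝ V o i) := by
  obtain ⟨a, m, b, ham, hmb, hab, h1, h2, h3⟩ := exists_path hM
  have hI := indep_iff cs hV ham hmb hab h1 h2 h3
  obtain ⟨n0, n1, n2⟩ := card_index cs a m b ham hmb hab hI
  have f0 := finrank_Xc cs hV 0
  have f1 := finrank_Xc cs hV 1
  have f2 := finrank_Xc cs hV 2
  rw [n0] at f0
  rw [n1] at f1
  rw [n2] at f2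
  have hfr : Module.finrank ℝ V = 3 := by simpa using hV.finrank_eq
  haveI : FiniteDimensional ℝ V := FiniteDimensional.of_finrank_pos (by omega)
  haveI : ∀ k, FiniteDimensional ℝ (Xc cs ℝ V k) := fun k => by
    classical infer_instance
  have hS : ∀ i, Indep cs {i} := by
    intro i x hx y hy hxy
    simp only [Finset.mem_singleton] at hx hy
    exact absurd (hx.trans hy.symm) hxy
  have hE : Indep cs (∅ : Finset (Fin 3)) := fun i hi => by simp at hi
  have hAB : Indep cs {a, b} := by
    rw [hI]; simp [ham.symm, hmb]
  have hU : ∀ U : {T : Finset (Fin 3) // Indep cs T ∧ T.card = 2}, U.1 = {a, b} := by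
    rintro ⟨U, hU, hc⟩
    rw [hI] at hU
    have : ∀ a m b : Fin 3, a ≠ m → m ≠ b → a ≠ b → ∀ U : Finset (Fin 3),
      (¬ (a ∈ U ∧ m ∈ U) ∧ ¬ (m ∈ U ∧ b ∈ U)) → U.card = 2 → U = {a, b} := by decide
    exact this a m b ham hmb hab U hU hc
  have ea : ({a, b} : Finset (Fin 3)).erase a = {b} := by
    ext x; simp only [mem_erase, mem_insert, mem_singleton]; grind
  have eb : ({a, b} : Finset (Fin 3)).erase b = {a} := by
    ext x; simp only [mem_erase, mem_insert, mem_singleton]; grind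
  -- formula for d^0
  have d0 : ∀ (x : Xc cs ℝ V 0) (i : Fin 3),
      (Xd cs ℝ V o 0 x ⟨{i}, hS i, by simp⟩ : V)
        = extz cs V x ∅ + cs.simple i • extz cs V x ∅ := by
    intro x i
    rw [Xd_eq]; simp [csgn_empty]
  -- formula for d^1
  have d1 : ∀ (x : Xc cs ℝ V 1) (U : {T : Finset (Fin 3) // Indep cs T ∧ T.card = 2}),
      (Xd cs ℝ V o 1 x U : V)
        = csgn o {b} a • (extz cs V x {b} + cs.simple a • extz cs V x {b})
        + csgn o {a} b • (extz cs V x {a} + cs.simple b • extz cs V x {a}) := by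
    intro x U
    rw [Xd_eq, hU U, Finset.sum_pair hab, ea, eb]
  have ker0 : LinearMap.ker (Xd cs ℝ V o 0) = ⊥ := by
    rw [Submodule.eq_bot_iff]
    intro x hx
    rw [LinearMap.mem_ker] at hx
    have key : ∀ i, ∃ c : ℝ, extz cs V x ∅ = c • α i := by
      intro i
      have h := d0 x i
      rw [hx, hV.smul_eq] at h
      simp only [Pi.zero_apply, ZeroMemClass.coe_zero] at h
      set v := extz cs V x ∅
      refine ⟨(1/2) * (2 * inner ℝ (α i) v / inner ℝ (α i) (α i)), ?_⟩
      rw [mul_smul]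
      generalize (2 * inner ℝ (α i) v / inner ℝ (α i) (α i)) • α i = w at h
      have h' : w = (2:ℝ) • v := by
        rw [two_smul, eq_comm, ← sub_eq_zero, h]; abel
      rw [h', smul_smul]; norm_num
    obtain ⟨c, hc⟩ := key a
    obtain ⟨c', hc'⟩ := key b
    have hz : c • α a + (-c') • α b = 0 := by
      rw [← hc, neg_smul, ← hc']; abel
    have := refl_pair cs hV hab _ _ hz
    rw [this.1, zero_smul] at hc
    funext T
    apply Subtype.ext
    change (x T : V) = (0 : V)
    rw [← extz_eq cs V x T, Finset.card_eq_zero.1 T.2.2, hc]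
  have surj1 : LinearMap.range (Xd cs ℝ V o 1) = ⊤ := by
    rw [LinearMap.range_eq_top]
    intro y
    let U : {T : Finset (Fin 3) // Indep cs T ∧ T.card = 2} :=
      ⟨{a, b}, hAB, Finset.card_pair hab⟩
    have hy := (y U).2
    set w : V := (y U : V) with hw
    have hwa : cs.simple a • w = w := hy a (by simp [U])
    have hwb : cs.simple b • w = w := hy b (by simp [U])
    let v : V := csgn o {a} b • ((1/2 : ℝ) • w)
    have hva : cs.simple a • v = v := by
      simp only [v]; rw [smul_comm, smul_comm (cs.simple a) (1/2 : ℝ), hwa]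
    have hvb : cs.simple b • v = v := by
      simp only [v]; rw [smul_comm, smul_comm (cs.simple b) (1/2 : ℝ), hwb]
    let x : Xc cs ℝ V 1 := fun T => ⟨if T.1 = {a} then v else 0, by
      split_ifs with h
      · rw [h]; intro i hi
        rw [Finset.mem_singleton.1 hi, hva]
      · exact Submodule.zero_mem _⟩
    refine ⟨x, ?_⟩
    have xa : extz cs V x {a} = v := by
      have := extz_eq cs V x ⟨{a}, hS a, by simp⟩
      simpa [x] using this
    have xb : extz cs V x {b} = 0 := by
      have := extz_eq cs V x ⟨{b}, hS b, by simp⟩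
      simpa [x, hab.symm] using this
    funext T
    have hT : T = U := Subtype.ext (hU T)
    subst hT
    apply Subtype.ext
    rw [d1, xa, xb, hvb, smul_zero, add_zero, smul_zero, zero_add, ← two_smul ℝ v, smul_comm]
    simp only [v]
    rw [smul_smul, csgn_sq, one_smul, smul_smul]
    norm_num [hw]
  have hle : Bc cs ℝ V o 1 ≤ Zc cs ℝ V o 1 := by
    rintro _ ⟨x, rfl⟩
    rw [Zc, LinearMap.mem_ker]
    funext T
    apply Subtype.ext
    change _ = (0 : V)
    have xa := extz_eq cs V (Xd cs ℝ V o 0 x) ⟨{a}, hS a, by simp⟩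
    have xb := extz_eq cs V (Xd cs ℝ V o 0 x) ⟨{b}, hS b, by simp⟩
    rw [d0] at xa xb
    simp only at xa xb
    rw [d1, xa, xb, csgn_anti o a b hab, neg_smul, neg_add_eq_zero]
    congr 1
    have hc := commute_of_two cs h3
    simp only [smul_add, smul_smul, hc.eq]
    abel
  refine ⟨?_, ?_⟩
  · apply FiniteDimensional.nonempty_linearEquiv_of_finrank_eq
    have g1 := Submodule.finrank_quotient_add_finrank
      ((Bc cs ℝ V o 1).comap (Zc cs ℝ V o 1).subtype)
    have g2 := (Submodule.comapSubtypeEquivOfLe hle).finrank_eq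
    have g3 := (Xd cs ℝ V o 0).finrank_range_add_finrank_ker
    have g4 := (Xd cs ℝ V o 1).finrank_range_add_finrank_ker
    rw [ker0, finrank_bot] at g3
    rw [surj1, finrank_top] at g4
    have g5 : Module.finrank ℝ (Bc cs ℝ V o 1) =
      Module.finrank ℝ (LinearMap.range (Xd cs ℝ V o 0)) := rfl
    have g6 : Module.finrank ℝ (Zc cs ℝ V o 1) =
      Module.finrank ℝ (LinearMap.ker (Xd cs ℝ V o 1)) := rfl
    rw [Module.finrank_fin_fun]
    change _ = 1 * (3 - 2) at f2
    have g4' := g4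
    rw [← g6, f1] at g4'
    have f2' : Module.finrank ℝ (Xc cs ℝ V (1 + 1)) = 1 * (3 - 2) := f2
    have f1' : Module.finrank ℝ (Xc cs ℝ V (0 + 1)) = 3 * (3 - 1) := f1
    have g7 : Module.finrank ℝ (Zc cs ℝ V o 1) = 5 := by omega
    have g8 : Module.finrank ℝ (Bc cs ℝ V o 1) = 3 := by omega
    rw [g2, g7, g8] at g1
    exact Nat.add_right_cancel (m := 3) g1
  · intro i hi
    match i, hi with
    | 0, _ =>
      have : Subsingleton (Zc cs ℝ V o 0) := by
        rw [Zc, ker0]; infer_instance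
      infer_instance
    | 2, _ =>
      apply Submodule.Quotient.subsingleton_iff.2
      have : Bc cs ℝ V o 2 = ⊤ := surj1
      rw [this, Submodule.comap_top]
    | k + 3, _ =>
      have : IsEmpty {T : Finset (Fin 3) // Indep cs T ∧ T.card = k + 3} := by
        constructor
        rintro ⟨T, hT, hc⟩
        have hle := Finset.card_le_univ T
        have : T = Finset.univ := by
          apply Finset.eq_univ_of_card
          simp only [Fintype.card_fin] at *
          omega
        rw [hI, this] at hT
        simp at hT
      have : Subsingleton (Xc cs ℝ V (k + 3)) := inferInstance
      infer_instance

end Statement
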